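/- In the one-dimensional exponential family setup, let θ₀ ≠ θ₁ be points of Θ, let θ₂ ∈ Θ be the point with η(θ₂) = (η(θ₀)+η(θ₁))/2, assume θ₂ is an interior point of Θ, let I(θ₂) := A''(η(θ₂))·(η'(θ₂))², and let w := (∫_X √(p_{θ₀}(x) p_{θ₁}(x)) dν(x))². Then E_{θ₁}[q_n^{θ₀}] = ψ_{θ₀,θ₁}(n) = (π(θ₀)/π(θ₂)) · ψ_{θ₂,θ₂}(n) · w^n, and ψ_{θ₀,θ₁}(n) is asymptotically equivalent to (π(θ₀)/π(θ₂)) · (√(I(θ₂))/(2√π)) · √n · w^n as n → ∞; that is, lim_{n→∞} ψ_{θ₀,θ₁}(n) · 2√π · π(θ₂) / (π(θ₀) · √(I(θ₂)) · √n · w^n) = 1. -/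

import Mathlib

open MeasureTheory

/-- The expected `θ₀`-posterior after `n` iid observations generated under `θ₁`:
`ψ_{θ₀,θ₁}(n) = ∫_{X^n} (p_{θ₀}(s_n) π(θ₀) / p(s_n)) p_{θ₁}(s_n) dν^n(s_n)`, where
`p_θ(s_n) = ∏ i, p_θ(x_i)` and `p(s_n) = ∫_Θ p_θ(s_n) π(θ) dθ`. -/
noncomputable def expectedPosterior {X : Type*} [MeasurableSpace X]
    (ν : Measure X) [SigmaFinite ν]
    (Θ : Set ℝ) (π : ℝ → ℝ) (p : ℝ → X → ℝ) (θ₀ θ₁ : ℝ) (n : ℕ) : ℝ :=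
  ∫ s : Fin n → X,
    ((∏ i, p θ₀ (s i)) * π θ₀ / ∫ θ in Θ, (∏ i, p θ (s i)) * π θ) *
      (∏ i, p θ₁ (s i)) ∂(Measure.pi fun _ => ν)

section

open Filter Topology ProbabilityTheory

theorem tendsto_integral_of_tendsto_of_continuousConvergence
    {P : ℕ → ProbabilityMeasure ℝ} {Q : ProbabilityMeasure ℝ} (hP : Tendsto P atTop (𝓝 Q))
    {G : ℕ → ℝ → ℝ} {g : ℝ → ℝ} {C : ℝ} (hG : ∀ n, Measurable (G n)) (hg : Continuous g)
    (hbound : ∀ᶠ n in atTop, ∀ z, |G n z| ≤ C)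
    (hconv : ∀ z, Tendsto (fun q : ℕ × ℝ => G q.1 q.2) (atTop ×ˢ 𝓝 z) (𝓝 (g z))) :
    Tendsto (fun n => ∫ z, G n z ∂(P n : Measure ℝ)) atTop (𝓝 (∫ z, g z ∂(Q : Measure ℝ))) := by
  have hgC : ∀ z, |g z| ≤ C := by
    intro z
    have h1 : Tendsto (fun n : ℕ => G n z) atTop (𝓝 (g z)) :=
      (hconv z).comp (tendsto_id.prodMk tendsto_const_nhds)
    exact le_of_tendsto h1.abs (hbound.mono fun n hn => hn z)
  have hC : 0 ≤ C := (abs_nonneg _).trans (hgC 0)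
  have hunif : ∀ K : Set ℝ, IsCompact K → TendstoUniformlyOn G g atTop K := by
    rw [← tendstoLocallyUniformly_iff_forall_isCompact, tendstoLocallyUniformly_iff_filter]
    intro z
    rw [Metric.tendstoUniformlyOnFilter_iff]
    intro ε hε
    have h1 : ∀ᶠ q : ℕ × ℝ in atTop ×ˢ 𝓝 z, dist (G q.1 q.2) (g z) < ε / 2 :=
      (Metric.tendsto_nhds.1 (hconv z)) _ (half_pos hε)
    have h2 : ∀ᶠ q : ℕ × ℝ in atTop ×ˢ 𝓝 z, dist (g q.2) (g z) < ε / 2 :=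
      (Metric.tendsto_nhds.1 (hg.continuousAt (x := z)) _ (half_pos hε)).prod_inr _
    filter_upwards [h1, h2] with q hq1 hq2
    calc dist (g q.2) (G q.1 q.2) ≤ dist (g q.2) (g z) + dist (G q.1 q.2) (g z) :=
          dist_triangle_right _ _ _
      _ < ε := by linarith
  have htight : IsTightMeasureSet {(μ : Measure ℝ) | μ ∈ insert Q (Set.range P)} :=
    isTightMeasureSet_of_isCompact_closure hP.isCompact_insert_range.closure
  rw [isTightMeasureSet_iff_exists_isCompact_measure_compl_le] at htight
  have hgint : ∀ n, Integrable g (P n : Measure ℝ) := fun n =>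
    .of_bound hg.aestronglyMeasurable C (.of_forall hgC)
  have hweak : Tendsto (fun n => ∫ z, g z ∂(P n : Measure ℝ)) atTop
      (𝓝 (∫ z, g z ∂(Q : Measure ℝ))) :=
    ProbabilityMeasure.tendsto_iff_forall_integral_tendsto.1 hP
      (BoundedContinuousFunction.ofNormedAddCommGroup g hg C hgC)
  have hdiff : Tendsto (fun n => ∫ z, (G n z - g z) ∂(P n : Measure ℝ)) atTop (𝓝 0) := by
    rw [Metric.tendsto_nhds]
    intro ε hε
    have hδ : 0 < ε / (4 * (C + 1)) := by positivity
    obtain ⟨K, hK, hKP⟩ := htight (ENNReal.ofReal (ε / (4 * (C + 1))))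
      (ENNReal.ofReal_pos.2 hδ)
    filter_upwards [hbound, Metric.tendstoUniformlyOn_iff.1 (hunif K hK) (ε / 4) (by positivity)]
      with n hb hu
    have hPK : (P n : Measure ℝ).real Kᶜ ≤ ε / (4 * (C + 1)) :=
      ENNReal.toReal_le_of_le_ofReal hδ.le (hKP _ ⟨P n, Or.inr ⟨n, rfl⟩, rfl⟩)
    have hKm : MeasurableSet K := hK.isClosed.measurableSet
    have hpt : ∀ z, ‖G n z - g z‖ ≤ ε / 4 + Kᶜ.indicator (fun _ => 2 * C) z := by
      intro z
      by_cases hz : z ∈ K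
      · have := hu z hz
        rw [dist_comm, Real.dist_eq] at this
        simpa [hz] using this.le
      · have h1 := hb z
        have h2 := hgC z
        have h3 := abs_sub (G n z) (g z)
        simp only [Set.mem_compl_iff, hz, not_false_eq_true, Set.indicator_of_mem,
          Real.norm_eq_abs]
        linarith
    have hintg : Integrable (fun z => ε / 4 + Kᶜ.indicator (fun _ => 2 * C) z)
        (P n : Measure ℝ) :=
      (integrable_const _).add ((integrable_const _).indicator hKm.compl)
    rw [dist_zero_right]
    calc ‖∫ z, (G n z - g z) ∂(P n : Measure ℝ)‖
        ≤ ∫ z, (ε / 4 + Kᶜ.indicator (fun _ => 2 * C) z) ∂(P n : Measure ℝ) :=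
          norm_integral_le_of_norm_le hintg (.of_forall hpt)
      _ = ε / 4 + (P n : Measure ℝ).real Kᶜ * (2 * C) := by
          rw [integral_add (integrable_const _) ((integrable_const _).indicator hKm.compl),
            integral_indicator_const _ hKm.compl]
          simp
      _ ≤ ε / 4 + ε / (4 * (C + 1)) * (2 * C) := by gcongr
      _ < ε := by
          have : ε / (4 * (C + 1)) * (2 * C) ≤ ε / 2 := by
            rw [div_mul_eq_mul_div, div_le_div_iff₀ (by positivity) (by positivity)]
            nlinarith
          linarith
  have := hdiff.add hweak
  rw [zero_add] at this
  refine this.congr' ?_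
  filter_upwards [hbound] with n hb
  rw [← integral_add]
  · simp
  · exact (Integrable.of_bound (hG n).aestronglyMeasurable C (.of_forall hb)).sub (hgint n)
  · exact hgint n

theorem tendsto_integral_pi_standardized_sum {X : Type*} [MeasurableSpace X] (μ : Measure X)
    [IsProbabilityMeasure μ] {T : X → ℝ} (hT : Measurable T) (hT2 : MemLp T 2 μ)
    {G : ℕ → ℝ → ℝ} {g : ℝ → ℝ} {C : ℝ} (hG : ∀ n, Measurable (G n)) (hg : Continuous g)
    (hbound : ∀ᶠ n in atTop, ∀ z, |G n z| ≤ C)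
    (hconv : ∀ z, Tendsto (fun q : ℕ × ℝ => G q.1 q.2) (atTop ×ˢ 𝓝 z) (𝓝 (g z))) :
    Tendsto (fun n : ℕ => ∫ s : Fin n → X,
        G n ((√n)⁻¹ * (∑ i, T (s i) - n * ∫ x, T x ∂μ)) ∂(Measure.pi fun _ => μ))
      atTop (𝓝 (∫ z, g z ∂(gaussianReal 0 Var[T; μ].toNNReal))) := by
  let P := Measure.infinitePi (fun _ : ℕ => μ)
  have heval : ∀ i, MeasurePreserving (fun ω : ℕ → X => ω i) P μ := fun i =>
    measurePreserving_eval_infinitePi _ i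
  have hident : ∀ i : ℕ, IdentDistrib (fun ω : ℕ → X => T (ω i)) (fun ω => T (ω 0)) P P := by
    intro i
    have h : IdentDistrib (fun ω : ℕ → X => ω i) (fun ω => ω 0) P P :=
      ⟨(heval i).aemeasurable, (heval 0).aemeasurable, by rw [(heval i).map_eq, (heval 0).map_eq]⟩
    exact h.comp hT
  have hmean : P[fun ω : ℕ → X => T (ω 0)] = ∫ x, T x ∂μ := by
    conv_rhs => rw [← (heval 0).map_eq]
    rw [integral_map (heval 0).measurable.aemeasurable hT.aestronglyMeasurable]
  have hvar : Var[fun ω : ℕ → X => T (ω 0); P] = Var[T; μ] := by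
    conv_rhs => rw [← (heval 0).map_eq]
    rw [variance_map hT.aemeasurable (heval 0).measurable.aemeasurable]
    rfl
  have hclt := tendstoInDistribution_inv_sqrt_mul_sum_sub (P := P)
    (X := fun i (ω : ℕ → X) => T (ω i)) (Y := id)
    (P' := gaussianReal 0 Var[fun ω : ℕ → X => T (ω 0); P].toNNReal)
    HasLaw.id (hT2.comp_measurePreserving (heval 0))
    (iIndepFun_infinitePi (fun _ => hT)) hident
  have hlim := tendsto_integral_of_tendsto_of_continuousConvergence hclt.tendsto hG hg hbound hconv
  simp only [ProbabilityMeasure.coe_mk, Measure.map_id, hvar] at hlim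
  refine hlim.congr fun n => ?_
  rw [integral_map (hclt.forall_aemeasurable n) (hG n).aestronglyMeasurable, hmean]
  have hpi : P.map (fun ω (i : Fin n) => ω i) = Measure.pi fun _ => μ := by
    rw [← Measure.infinitePi_eq_pi]
    exact Measure.map_infinitePi_infinitePi_of_inj Fin.val_injective
  have hmeas : Measurable fun s : Fin n → X =>
      G n ((√n)⁻¹ * (∑ i, T (s i) - n * ∫ x, T x ∂μ)) :=
    (hG n).comp (by fun_prop)
  have hrestrict : Measurable fun (ω : ℕ → X) (i : Fin n) => ω i := by fun_prop
  rw [← hpi, integral_map hrestrict.aemeasurable hmeas.aestronglyMeasurable]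
  simp only [Finset.sum_range]

theorem integral_exp_mul_sub_mul_sq {J : ℝ} (hJ : 0 < J) (y : ℝ) :
    ∫ u : ℝ, Real.exp (y * u - J * u ^ 2) = √(Real.pi / J) * Real.exp (y ^ 2 / (4 * J)) := by
  have h : ∀ u : ℝ, Real.exp (y * u - J * u ^ 2) =
      Real.exp (-J * (u - y / (2 * J)) ^ 2) * Real.exp (y ^ 2 / (4 * J)) := by
    intro u
    rw [← Real.exp_add]
    congr 1
    field_simp
    ring
  simp_rw [h]
  rw [integral_mul_const, integral_sub_right_eq_self (fun u : ℝ => Real.exp (-J * u ^ 2)),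
    integral_gaussian]

/-- The scaled Laplace integral over a neighbourhood of the maximum, with linear perturbation `z`
of the exponent, converges continuously in `z`. -/
theorem tendsto_sqrt_mul_setIntegral_ball {t r a b c J : ℝ} {ρ x D : ℝ → ℝ} (hr : 0 < r)
    (hc : 0 < c) (hJ : 0 < J)
    (hρc : ContinuousOn ρ (Metric.ball t r)) (hxc : ContinuousOn x (Metric.ball t r))
    (hDc : ContinuousOn D (Metric.ball t r)) (hρt : ρ t = 1)
    (hρ0 : ∀ θ ∈ Metric.ball t r, 0 ≤ ρ θ) (hρ2 : ∀ θ ∈ Metric.ball t r, ρ θ ≤ 2)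
    (hxb : ∀ θ ∈ Metric.ball t r, |x θ| ≤ b * |θ - t|)
    (hDb : ∀ θ ∈ Metric.ball t r, c * (θ - t) ^ 2 ≤ D θ)
    (hx : Tendsto (fun θ => x θ / (θ - t)) (𝓝[≠] t) (𝓝 a))
    (hD : Tendsto (fun θ => D θ / (θ - t) ^ 2) (𝓝[≠] t) (𝓝 J)) (z₀ : ℝ) :
    Tendsto (fun q : ℕ × ℝ => √q.1 * ∫ θ in Metric.ball t r,
        ρ θ * Real.exp (√q.1 * x θ * q.2 - q.1 * D θ))
      (atTop ×ˢ 𝓝 z₀) (𝓝 (√(Real.pi / J) * Real.exp ((a * z₀) ^ 2 / (4 * J)))) := by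
  set U := Metric.ball t r with hU
  have htU : t ∈ U := Metric.mem_ball_self hr
  have hUo : IsOpen U := Metric.isOpen_ball
  set F : ℕ × ℝ → ℝ → ℝ := fun q =>
    U.indicator (fun θ => ρ θ * Real.exp (√q.1 * x θ * q.2 - q.1 * D θ)) with hF
  have hFm : ∀ q, Measurable (F q) := by
    classical
    intro q
    have h : ContinuousOn (fun θ => ρ θ * Real.exp (√q.1 * x θ * q.2 - q.1 * D θ)) U := by
      fun_prop
    have := h.measurable_piecewise (g := fun _ => 0) continuousOn_const hUo.measurableSet
    simpa only [hF, Set.piecewise_eq_indicator] using! this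
  have hn1 : ∀ᶠ q : ℕ × ℝ in atTop ×ˢ 𝓝 z₀, 1 ≤ q.1 := (eventually_ge_atTop 1).prod_inl _
  have heq : (fun q : ℕ × ℝ => √q.1 * ∫ θ in U, ρ θ * Real.exp (√q.1 * x θ * q.2 - q.1 * D θ))
      =ᶠ[atTop ×ˢ 𝓝 z₀] fun q => ∫ u, F q (t + (√q.1)⁻¹ * u) := by
    filter_upwards [hn1] with q hq
    rw [Measure.integral_comp_mul_left (fun y => F q (t + y)), integral_add_left_eq_self,
      integral_indicator hUo.measurableSet, inv_inv, abs_of_nonneg (Real.sqrt_nonneg _),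
      smul_eq_mul]
  rw [tendsto_congr' heq, ← integral_exp_mul_sub_mul_sq hJ]
  set M := |z₀| + 1 with hM
  have hMz : ∀ᶠ q : ℕ × ℝ in atTop ×ˢ 𝓝 z₀, |q.2| ≤ M := by
    have : ∀ᶠ z in 𝓝 z₀, |z| ≤ M :=
      (continuous_abs.tendsto z₀).eventually_le_const (by simp [hM])
    exact this.prod_inr _
  have hM0 : 0 ≤ M := by positivity
  refine tendsto_integral_filter_of_dominated_convergence
    (fun u => 2 * Real.exp ((b * M) ^ 2 / (2 * c)) * Real.exp (-(c / 2) * u ^ 2)) ?_ ?_ ?_ ?_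
  · exact .of_forall fun q => ((hFm q).comp (by fun_prop)).aestronglyMeasurable
  · filter_upwards [hn1, hMz] with q hq hz
    refine .of_forall fun u => ?_
    have hs : (0 : ℝ) < √q.1 := Real.sqrt_pos.2 (by exact_mod_cast hq)
    have hsq : (√q.1 : ℝ) ^ 2 = q.1 := Real.sq_sqrt (Nat.cast_nonneg _)
    by_cases hu : t + (√q.1)⁻¹ * u ∈ U
    · have h0 := hρ0 _ hu
      have h2 := hρ2 _ hu
      have h3 := hxb _ hu
      have h4 := hDb _ hu
      simp only [hF, Set.indicator_of_mem hu]
      set θ := t + (√q.1)⁻¹ * u with hθ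
      have hθt : θ - t = (√q.1)⁻¹ * u := by simp [hθ]
      rw [Real.norm_eq_abs, abs_mul, abs_of_nonneg h0, Real.abs_exp, mul_assoc (2 : ℝ),
        ← Real.exp_add]
      refine mul_le_mul h2 (Real.exp_le_exp.2 ?_) (Real.exp_pos _).le zero_le_two
      have h5 : √q.1 * x θ * q.2 ≤ b * |u| * M := by
        have : √q.1 * |x θ| ≤ b * |u| := by
          calc √q.1 * |x θ| ≤ √q.1 * (b * |θ - t|) := by gcongr
            _ = b * |u| := by
              rw [hθt, abs_mul, abs_inv, abs_of_pos hs]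
              field_simp
        calc √q.1 * x θ * q.2 ≤ |√q.1 * x θ * q.2| := le_abs_self _
          _ = √q.1 * |x θ| * |q.2| := by rw [abs_mul, abs_mul, abs_of_pos hs]
          _ ≤ b * |u| * M := by
            refine mul_le_mul this hz (abs_nonneg _) (le_trans (by positivity) this)
      have h6 : c * u ^ 2 ≤ q.1 * D θ := by
        calc c * u ^ 2 = q.1 * (c * (θ - t) ^ 2) := by
              rw [hθt, mul_pow, inv_pow, hsq]
              field_simp
          _ ≤ q.1 * D θ := by gcongr
      have h7 : b * |u| * M ≤ (b * M) ^ 2 / (2 * c) + c / 2 * u ^ 2 := by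
        rw [← sq_abs u, ← sub_nonneg]
        have : (b * M) ^ 2 / (2 * c) + c / 2 * |u| ^ 2 - b * |u| * M =
            (b * M - c * |u|) ^ 2 / (2 * c) := by
          field_simp
          ring
        rw [this]
        positivity
      linarith
    · simp only [hF, Set.indicator_of_notMem hu, norm_zero]
      positivity
  · exact (integrable_exp_neg_mul_sq (half_pos hc)).const_mul _
  · filter_upwards [Measure.ae_ne volume (0 : ℝ)] with u hu
    have hpt : Tendsto (fun q : ℕ × ℝ => t + (√q.1)⁻¹ * u) (atTop ×ˢ 𝓝 z₀) (𝓝[≠] t) := by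
      refine tendsto_nhdsWithin_iff.2 ⟨?_, ?_⟩
      · have h1 : Tendsto (fun q : ℕ × ℝ => (√(q.1 : ℝ))⁻¹) (atTop ×ˢ 𝓝 z₀) (𝓝 0) :=
          (tendsto_inv_atTop_zero.comp (Real.tendsto_sqrt_atTop.comp
            tendsto_natCast_atTop_atTop)).comp tendsto_fst
        simpa using (h1.mul_const u).const_add t
      · filter_upwards [hn1] with q hq
        have hs : (0 : ℝ) < √q.1 := Real.sqrt_pos.2 (by exact_mod_cast hq)
        simp [hu, hs.ne']
    have hptU : ∀ᶠ q : ℕ × ℝ in atTop ×ˢ 𝓝 z₀, t + (√q.1)⁻¹ * u ∈ U :=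
      (tendsto_nhds_of_tendsto_nhdsWithin hpt).eventually (hUo.mem_nhds htU)
    have hρlim : Tendsto (fun q : ℕ × ℝ => ρ (t + (√q.1)⁻¹ * u)) (atTop ×ˢ 𝓝 z₀) (𝓝 1) :=
      hρt ▸ (hρc.continuousAt (hUo.mem_nhds htU)).tendsto.comp
        (tendsto_nhds_of_tendsto_nhdsWithin hpt)
    have hxlim : Tendsto (fun q : ℕ × ℝ => √q.1 * x (t + (√q.1)⁻¹ * u)) (atTop ×ˢ 𝓝 z₀)
        (𝓝 (a * u)) := by
      refine ((hx.comp hpt).mul_const u).congr' ?_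
      filter_upwards [hn1] with q hq
      have hs : (0 : ℝ) < √q.1 := Real.sqrt_pos.2 (by exact_mod_cast hq)
      simp only [Function.comp_apply, add_sub_cancel_left]
      field_simp
    have hDlim : Tendsto (fun q : ℕ × ℝ => q.1 * D (t + (√q.1)⁻¹ * u)) (atTop ×ˢ 𝓝 z₀)
        (𝓝 (J * u ^ 2)) := by
      refine ((hD.comp hpt).mul_const (u ^ 2)).congr' ?_
      filter_upwards [hn1] with q hq
      have hq' : (0 : ℝ) < q.1 := by exact_mod_cast hq
      have hsq : (√q.1 : ℝ) ^ 2 = q.1 := Real.sq_sqrt hq'.le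
      simp only [Function.comp_apply, add_sub_cancel_left, mul_pow, inv_pow, hsq]
      field_simp
    have hlim := hρlim.mul (Real.continuous_exp.tendsto _ |>.comp
      ((hxlim.mul tendsto_snd).sub hDlim))
    rw [one_mul] at hlim
    have hval : a * z₀ * u - J * u ^ 2 = a * u * z₀ - J * u ^ 2 := by ring
    rw [hval]
    refine hlim.congr' ?_
    filter_upwards [hptU] with q hq
    simp [hF, hq]

/-- Laplace asymptotics of the scaled integral over `Θ`, uniformly in the linear perturbation `z`:
the exponent is controlled quadratically near `t` and linearly in `|x|` away from `t`. -/
theorem tendsto_sqrt_mul_setIntegral {Θ : Set ℝ} {t r a b c J κ δ : ℝ} {ρ x D : ℝ → ℝ}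
    (hΘ : MeasurableSet Θ) (hr : 0 < r) (hUΘ : Metric.ball t r ⊆ Θ) (hb : 0 ≤ b)
    (hc : 0 < c) (hJ : 0 < J) (hκ : 0 < κ) (hδ : 0 < δ)
    (hρc : ContinuousOn ρ Θ) (hxc : ContinuousOn x Θ) (hDc : ContinuousOn D Θ) (hρt : ρ t = 1)
    (hρi : IntegrableOn ρ Θ) (hρ0 : ∀ θ ∈ Θ, 0 ≤ ρ θ)
    (hρ2 : ∀ θ ∈ Metric.ball t r, ρ θ ≤ 2)
    (hxb : ∀ θ ∈ Metric.ball t r, |x θ| ≤ b * |θ - t|)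
    (hDb : ∀ θ ∈ Metric.ball t r, c * (θ - t) ^ 2 ≤ D θ)
    (hfar : ∀ θ ∈ Θ \ Metric.ball t r, κ * |x θ| ≤ D θ ∧ δ ≤ |x θ|)
    (hx : Tendsto (fun θ => x θ / (θ - t)) (𝓝[≠] t) (𝓝 a))
    (hD : Tendsto (fun θ => D θ / (θ - t) ^ 2) (𝓝[≠] t) (𝓝 J)) (z₀ : ℝ) :
    Tendsto (fun q : ℕ × ℝ => √q.1 * ∫ θ in Θ,
        ρ θ * Real.exp (√q.1 * x θ * q.2 - q.1 * D θ))
      (atTop ×ˢ 𝓝 z₀) (𝓝 (√(Real.pi / J) * Real.exp ((a * z₀) ^ 2 / (4 * J)))) := by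
  have hnear := tendsto_sqrt_mul_setIntegral_ball hr hc hJ (hρc.mono hUΘ) (hxc.mono hUΘ)
    (hDc.mono hUΘ) hρt (fun θ hθ => hρ0 θ (hUΘ hθ)) hρ2 hxb hDb hx hD z₀
  set U := Metric.ball t r with hU
  have hUm : MeasurableSet U := Metric.isOpen_ball.measurableSet
  set f : ℕ × ℝ → ℝ → ℝ := fun q θ => ρ θ * Real.exp (√q.1 * x θ * q.2 - q.1 * D θ) with hf
  set M := |z₀| + 1 with hM
  have hM0 : 0 ≤ M := by positivity
  have hMz : ∀ᶠ q : ℕ × ℝ in atTop ×ˢ 𝓝 z₀, |q.2| ≤ M := by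
    have : ∀ᶠ z in 𝓝 z₀, |z| ≤ M :=
      (continuous_abs.tendsto z₀).eventually_le_const (by simp [hM])
    exact this.prod_inr _
  have hsqrt : Tendsto (fun n : ℕ => √(n : ℝ)) atTop atTop :=
    Real.tendsto_sqrt_atTop.comp tendsto_natCast_atTop_atTop
  have hlarge : ∀ᶠ q : ℕ × ℝ in atTop ×ˢ 𝓝 z₀, 2 * M / κ ≤ √q.1 :=
    (hsqrt.eventually_ge_atTop _).prod_inl _
  have hfm : ∀ q, AEStronglyMeasurable (f q) (volume.restrict Θ) := fun q =>
    ContinuousOn.aestronglyMeasurable (by fun_prop) hΘ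
  have hmul : ∀ q : ℕ × ℝ, ∀ θ, |q.2| ≤ M → √q.1 * x θ * q.2 ≤ √q.1 * |x θ| * M := by
    intro q θ hz
    calc √q.1 * x θ * q.2 ≤ |√q.1 * x θ * q.2| := le_abs_self _
      _ = √q.1 * |x θ| * |q.2| := by
        rw [abs_mul, abs_mul, abs_of_nonneg (Real.sqrt_nonneg _)]
      _ ≤ √q.1 * |x θ| * M := by gcongr
  have hfarle : ∀ q : ℕ × ℝ, |q.2| ≤ M → 2 * M / κ ≤ √q.1 → ∀ θ ∈ Θ \ U,
      f q θ ≤ ρ θ * Real.exp (-(κ * δ / 2) * q.1) := by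
    intro q hz hq θ hθ
    obtain ⟨h1, h2⟩ := hfar θ hθ
    refine mul_le_mul_of_nonneg_left (Real.exp_le_exp.2 ?_) (hρ0 θ hθ.1)
    have h3 := hmul q θ hz
    have hsq : √(q.1 : ℝ) * √(q.1 : ℝ) = q.1 := Real.mul_self_sqrt (Nat.cast_nonneg _)
    have h4 : √q.1 * M ≤ κ / 2 * q.1 := by
      rw [div_le_iff₀ hκ] at hq
      nlinarith [Real.sqrt_nonneg (q.1 : ℝ)]
    have h5 : √q.1 * |x θ| * M ≤ κ / 2 * q.1 * |x θ| := by
      calc √q.1 * |x θ| * M = √q.1 * M * |x θ| := by ring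
        _ ≤ κ / 2 * q.1 * |x θ| := by gcongr
    have h6 : q.1 * (κ * |x θ|) ≤ q.1 * D θ := by gcongr
    have h7 : κ / 2 * q.1 * δ ≤ κ / 2 * q.1 * |x θ| := by gcongr
    linarith
  have hf0 : ∀ q, ∀ θ ∈ Θ, 0 ≤ f q θ := fun q θ hθ => mul_nonneg (hρ0 θ hθ) (Real.exp_pos _).le
  have hfarint : ∀ q : ℕ × ℝ, |q.2| ≤ M → 2 * M / κ ≤ √q.1 → IntegrableOn (f q) (Θ \ U) := by
    intro q hz hq
    refine Integrable.mono' ((hρi.mono_set Set.sdiff_subset).mul_const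
      (Real.exp (-(κ * δ / 2) * q.1))) ((hfm q).mono_measure
        (Measure.restrict_mono Set.sdiff_subset le_rfl)) ?_
    refine (ae_restrict_iff' (hΘ.diff hUm)).2 (.of_forall fun θ hθ => ?_)
    rw [Real.norm_of_nonneg (hf0 q θ hθ.1)]
    exact hfarle q hz hq θ hθ
  have hnearint : ∀ q : ℕ × ℝ, |q.2| ≤ M → IntegrableOn (f q) U := by
    intro q hz
    refine Integrable.mono' ((hρi.mono_set hUΘ).mul_const
      (Real.exp (√q.1 * (b * r) * M))) ((hfm q).mono_measure
        (Measure.restrict_mono hUΘ le_rfl)) ?_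
    refine (ae_restrict_iff' hUm).2 (.of_forall fun θ hθ => ?_)
    rw [Real.norm_of_nonneg (hf0 q θ (hUΘ hθ))]
    refine mul_le_mul_of_nonneg_left (Real.exp_le_exp.2 ?_) (hρ0 θ (hUΘ hθ))
    have h1 : |θ - t| ≤ r := by simpa [Real.dist_eq] using (Metric.mem_ball.1 hθ).le
    have h2 : 0 ≤ q.1 * D θ :=
      mul_nonneg (Nat.cast_nonneg _) (le_trans (by positivity) (hDb θ hθ))
    have h3 : √q.1 * |x θ| * M ≤ √q.1 * (b * r) * M := by
      gcongr
      exact (hxb θ hθ).trans (by gcongr)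
    linarith [hmul q θ hz]
  have hfarlim : Tendsto (fun q : ℕ × ℝ => √q.1 * ∫ θ in Θ \ U, f q θ) (atTop ×ˢ 𝓝 z₀)
      (𝓝 0) := by
    have hup : Tendsto (fun q : ℕ × ℝ =>
        (q.1 : ℝ) ^ (1 / 2 : ℝ) * Real.exp (-(κ * δ / 2) * q.1) * ∫ θ in Θ \ U, ρ θ)
        (atTop ×ˢ 𝓝 z₀) (𝓝 0) := by
      have := ((tendsto_rpow_mul_exp_neg_mul_atTop_nhds_zero (1 / 2) (κ * δ / 2)
        (by positivity)).comp (tendsto_natCast_atTop_atTop (R := ℝ))).comp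
          (tendsto_fst (f := atTop) (g := 𝓝 z₀))
      simpa using this.mul_const (∫ θ in Θ \ U, ρ θ)
    refine tendsto_of_tendsto_of_tendsto_of_le_of_le' tendsto_const_nhds hup ?_ ?_
    · exact .of_forall fun q => mul_nonneg (Real.sqrt_nonneg _)
        (setIntegral_nonneg (hΘ.diff hUm) fun θ hθ => hf0 q θ hθ.1)
    · filter_upwards [hMz, hlarge] with q hz hq
      rw [← Real.sqrt_eq_rpow, mul_assoc]
      gcongr
      calc ∫ θ in Θ \ U, f q θ ≤ ∫ θ in Θ \ U, ρ θ * Real.exp (-(κ * δ / 2) * q.1) :=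
            setIntegral_mono_on (hfarint q hz hq)
              ((hρi.mono_set Set.sdiff_subset).mul_const _) (hΘ.diff hUm) (hfarle q hz hq)
        _ = Real.exp (-(κ * δ / 2) * q.1) * ∫ θ in Θ \ U, ρ θ := by
            rw [integral_mul_const, mul_comm]
  have hsum := hnear.add hfarlim
  rw [add_zero] at hsum
  refine hsum.congr' ?_
  filter_upwards [hMz, hlarge] with q hz hq
  rw [← mul_add, ← setIntegral_union Set.disjoint_sdiff_right (hΘ.diff hUm) (hnearint q hz)
    (hfarint q hz hq), Set.union_sdiff_cancel hUΘ]

/-- If `x` has the sign of `θ - t` near `t`, the inverse of the scaled Laplace integral is bounded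
uniformly in the linear perturbation `z`; no integrability is needed because the Bochner integral
vanishes otherwise. -/
theorem abs_inv_sqrt_mul_setIntegral_le {Θ : Set ℝ} {t r K : ℝ} {ρ x D : ℝ → ℝ}
    (hΘ : MeasurableSet Θ) (hr : 0 < r) (hUΘ : Metric.ball t r ⊆ Θ)
    (hρ0 : ∀ θ ∈ Θ, 0 ≤ ρ θ) (hρ1 : ∀ θ ∈ Metric.ball t r, 1 / 2 ≤ ρ θ) (hK : 0 ≤ K)
    (hsign : ∀ θ ∈ Metric.ball t r, 0 ≤ x θ * (θ - t))
    (hDK : ∀ θ ∈ Metric.ball t r, D θ ≤ K * (θ - t) ^ 2) {n : ℕ} (hn : 1 ≤ n) (z : ℝ) :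
    |(√n * ∫ θ in Θ, ρ θ * Real.exp (√n * x θ * z - n * D θ))⁻¹| ≤
      (r * (1 / 2 * Real.exp (-(K * r ^ 2))))⁻¹ := by
  set f : ℝ → ℝ := fun θ => ρ θ * Real.exp (√n * x θ * z - n * D θ) with hf
  have hf0 : ∀ θ ∈ Θ, 0 ≤ f θ := fun θ hθ => mul_nonneg (hρ0 θ hθ) (Real.exp_pos _).le
  by_cases hintg : IntegrableOn f Θ
  swap
  · rw [integral_undef hintg]
    simp only [mul_zero, inv_zero, abs_zero]
    positivity
  have hn' : (1 : ℝ) ≤ n := by exact_mod_cast hn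
  have hs : 0 < √(n : ℝ) := Real.sqrt_pos.2 (by linarith)
  have hs1 : 1 ≤ √(n : ℝ) := Real.one_le_sqrt.2 hn'
  have hsq : √(n : ℝ) ^ 2 = n := Real.sq_sqrt (by linarith)
  have hrs : r / √n ≤ r := div_le_self hr.le hs1
  obtain ⟨S, hSm, hSU, hSvol, hSr, hSz⟩ : ∃ S : Set ℝ, MeasurableSet S ∧ S ⊆ Metric.ball t r ∧
      volume.real S = r / √n ∧ (∀ θ ∈ S, |θ - t| ≤ r / √n) ∧
        ∀ θ ∈ S, θ - t ≠ 0 ∧ 0 ≤ (θ - t) * z := by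
    rcases le_total 0 z with hz | hz
    · refine ⟨Set.Ioo t (t + r / √n), measurableSet_Ioo, fun θ hθ => ?_, ?_, fun θ hθ => ?_,
        fun θ hθ => ⟨(sub_pos.2 hθ.1).ne', mul_nonneg (sub_pos.2 hθ.1).le hz⟩⟩
      · rw [Metric.mem_ball, Real.dist_eq, abs_lt]
        constructor <;> linarith [hθ.1, hθ.2]
      · rw [Real.volume_real_Ioo_of_le (by linarith [div_pos hr hs])]
        ring
      · rw [abs_le]
        constructor <;> linarith [hθ.1, hθ.2, div_pos hr hs]
    · refine ⟨Set.Ioo (t - r / √n) t, measurableSet_Ioo, fun θ hθ => ?_, ?_, fun θ hθ => ?_,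
        fun θ hθ => ⟨(sub_neg.2 hθ.2).ne,
          mul_nonneg_of_nonpos_of_nonpos (sub_neg.2 hθ.2).le hz⟩⟩
      · rw [Metric.mem_ball, Real.dist_eq, abs_lt]
        constructor <;> linarith [hθ.1, hθ.2]
      · rw [Real.volume_real_Ioo_of_le (by linarith [div_pos hr hs])]
        ring
      · rw [abs_le]
        constructor <;> linarith [hθ.1, hθ.2, div_pos hr hs]
  have hSfin : volume S ≠ ⊤ := ((measure_mono hSU).trans_lt measure_ball_lt_top).ne
  have hfS : ∀ θ ∈ S, 1 / 2 * Real.exp (-(K * r ^ 2)) ≤ f θ := by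
    intro θ hθ
    refine mul_le_mul (hρ1 θ (hSU hθ)) (Real.exp_le_exp.2 ?_) (Real.exp_pos _).le
      (hρ0 θ (hUΘ (hSU hθ)))
    have h1 : 0 ≤ x θ * z := by
      obtain ⟨hne, hz⟩ := hSz θ hθ
      have h2 : 0 < (θ - t) ^ 2 := by positivity
      refine nonneg_of_mul_nonneg_left (b := (θ - t) ^ 2) ?_ h2
      linarith [mul_nonneg (hsign θ (hSU hθ)) hz,
        show x θ * z * (θ - t) ^ 2 = x θ * (θ - t) * ((θ - t) * z) by ring]
    have h2 : 0 ≤ √n * x θ * z := by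
      rw [mul_assoc]
      positivity
    have h3 : n * D θ ≤ K * r ^ 2 := by
      have h4 : (θ - t) ^ 2 ≤ (r / √n) ^ 2 := by
        rw [← sq_abs]
        gcongr
        exact hSr θ hθ
      calc n * D θ ≤ n * (K * (r / √n) ^ 2) := by
            gcongr
            exact (hDK θ (hSU hθ)).trans (by gcongr)
        _ = K * r ^ 2 := by
            rw [div_pow, hsq]
            field_simp
    linarith
  have hlow : r * (1 / 2 * Real.exp (-(K * r ^ 2))) ≤ √n * ∫ θ in Θ, f θ := by
    calc r * (1 / 2 * Real.exp (-(K * r ^ 2)))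
        = √n * ∫ _ in S, 1 / 2 * Real.exp (-(K * r ^ 2)) := by
          rw [setIntegral_const, hSvol, smul_eq_mul]
          field_simp
      _ ≤ √n * ∫ θ in S, f θ := by
          refine mul_le_mul_of_nonneg_left ?_ hs.le
          exact setIntegral_mono_on (integrableOn_const hSfin) (hintg.mono_set (hSU.trans hUΘ))
            hSm hfS
      _ ≤ √n * ∫ θ in Θ, f θ := by
          refine mul_le_mul_of_nonneg_left ?_ hs.le
          exact setIntegral_mono_set hintg ((ae_restrict_iff' hΘ).2 (.of_forall hf0))
            (hSU.trans hUΘ).eventuallyLE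
  have hpos : 0 < r * (1 / 2 * Real.exp (-(K * r ^ 2))) := by positivity
  rw [abs_of_nonneg (inv_nonneg.2 (hpos.le.trans hlow))]
  exact inv_anti₀ hpos hlow

theorem exists_ball_local_bounds {Θ : Set ℝ} {t a J : ℝ} {ρ x D : ℝ → ℝ} (hΘ : Θ ∈ 𝓝 t)
    (ha : 0 < a) (hJ : 0 < J) (hρ : ContinuousAt ρ t) (hρt : ρ t = 1) (hxt : x t = 0)
    (hDt : D t = 0) (hx : Tendsto (fun θ => x θ / (θ - t)) (𝓝[≠] t) (𝓝 a))
    (hD : Tendsto (fun θ => D θ / (θ - t) ^ 2) (𝓝[≠] t) (𝓝 J)) :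
    ∃ r > 0, Metric.ball t r ⊆ Θ ∧ ∀ θ ∈ Metric.ball t r, 1 / 2 ≤ ρ θ ∧ ρ θ ≤ 2 ∧
      |x θ| ≤ 2 * a * |θ - t| ∧ 0 ≤ x θ * (θ - t) ∧
      J / 2 * (θ - t) ^ 2 ≤ D θ ∧ D θ ≤ 2 * J * (θ - t) ^ 2 := by
  have hρ1 : ∀ᶠ θ in 𝓝 t, 1 / 2 < ρ θ := hρ.eventually_const_lt (by rw [hρt]; norm_num)
  have hρ2 : ∀ᶠ θ in 𝓝 t, ρ θ < 2 := hρ.eventually_lt_const (by rw [hρt]; norm_num)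
  have hx0 : ∀ᶠ θ in 𝓝 t, |x θ| ≤ 2 * a * |θ - t| ∧ 0 ≤ x θ * (θ - t) := by
    have h : ∀ᶠ θ in 𝓝[≠] t, 0 < x θ / (θ - t) ∧ x θ / (θ - t) < 2 * a :=
      (hx.eventually_const_lt ha).and (hx.eventually_lt_const (by linarith))
    rw [eventually_nhdsWithin_iff] at h
    filter_upwards [h] with θ hθ
    rcases eq_or_ne θ t with rfl | hne
    · simp [hxt]
    · obtain ⟨h1, h2⟩ := hθ hne
      have h3 : θ - t ≠ 0 := sub_ne_zero.2 hne
      have h4 : x θ = x θ / (θ - t) * (θ - t) := by field_simp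
      constructor
      · rw [h4, abs_mul, abs_of_pos h1]
        gcongr
      · rw [h4, mul_assoc]
        exact mul_nonneg h1.le (mul_self_nonneg _)
  have hD0 : ∀ᶠ θ in 𝓝 t, J / 2 * (θ - t) ^ 2 ≤ D θ ∧ D θ ≤ 2 * J * (θ - t) ^ 2 := by
    have h : ∀ᶠ θ in 𝓝[≠] t, J / 2 < D θ / (θ - t) ^ 2 ∧ D θ / (θ - t) ^ 2 < 2 * J :=
      (hD.eventually_const_lt (by linarith)).and (hD.eventually_lt_const (by linarith))
    rw [eventually_nhdsWithin_iff] at h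
    filter_upwards [h] with θ hθ
    rcases eq_or_ne θ t with rfl | hne
    · simp [hDt]
    · obtain ⟨h1, h2⟩ := hθ hne
      have h3 : 0 < (θ - t) ^ 2 := by
        have := sub_ne_zero.2 hne
        positivity
      exact ⟨((lt_div_iff₀ h3).1 h1).le, ((div_lt_iff₀ h3).1 h2).le⟩
  obtain ⟨r, hr, h⟩ := Metric.eventually_nhds_iff_ball.1
    (((eventually_mem_set.2 hΘ).and (hρ1.and hρ2)).and (hx0.and hD0))
  exact ⟨r, hr, fun θ hθ => (h θ hθ).1.1, fun θ hθ =>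
    ⟨(h θ hθ).1.2.1.le, (h θ hθ).1.2.2.le, (h θ hθ).2.1.1, (h θ hθ).2.1.2, (h θ hθ).2.2⟩⟩

/-- Secant bounds: a function convex on a set grows at least linearly beyond points where it
exceeds its tangent at `y₀`. -/
theorem ConvexOn.exists_mul_abs_le {S : Set ℝ} {A : ℝ → ℝ} (hA : ConvexOn ℝ S A) {y₀ y₁ y₂ m : ℝ}
    (h₀ : y₀ ∈ S) (h₁ : y₁ ∈ S) (h₂ : y₂ ∈ S) (h10 : y₁ < y₀) (h02 : y₀ < y₂)
    (hD₁ : 0 < A y₁ - A y₀ - (y₁ - y₀) * m) (hD₂ : 0 < A y₂ - A y₀ - (y₂ - y₀) * m) :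
    ∃ κ > 0, ∀ y ∈ S, (y ≤ y₁ ∨ y₂ ≤ y) → κ * |y - y₀| ≤ A y - A y₀ - (y - y₀) * m := by
  have hκ₁ : 0 < (A y₁ - A y₀ - (y₁ - y₀) * m) / (y₀ - y₁) := div_pos hD₁ (by linarith)
  have hκ₂ : 0 < (A y₂ - A y₀ - (y₂ - y₀) * m) / (y₂ - y₀) := div_pos hD₂ (by linarith)
  refine ⟨_, lt_min hκ₁ hκ₂, fun y hy hyy => ?_⟩
  rcases hyy with hyy | hyy
  · have h := hA.secant_mono h₀ hy h₁ (by linarith) (by linarith) hyy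
    have hneg : y - y₀ < 0 := by linarith
    rw [abs_of_neg hneg]
    calc _ ≤ (A y₁ - A y₀ - (y₁ - y₀) * m) / (y₀ - y₁) * -(y - y₀) := by
          gcongr
          · linarith
          · exact min_le_left _ _
      _ = ((A y₁ - A y₀) / (y₁ - y₀) - m) * (y - y₀) := by
          have h3 : y₀ - y₁ ≠ 0 := by linarith
          have h4 : y₁ - y₀ ≠ 0 := by linarith
          have h5 : y₀ - y₁ = -(y₁ - y₀) := by ring
          rw [h5]
          field_simp
      _ ≤ ((A y - A y₀) / (y - y₀) - m) * (y - y₀) :=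
          mul_le_mul_of_nonpos_right (by linarith) hneg.le
      _ = _ := by
          have := hneg.ne
          field_simp
  · have h := hA.secant_mono h₀ h₂ hy (by linarith) (by linarith) hyy
    have hpos : 0 < y - y₀ := by linarith
    rw [abs_of_pos hpos]
    calc _ ≤ (A y₂ - A y₀ - (y₂ - y₀) * m) / (y₂ - y₀) * (y - y₀) := by
          gcongr
          exact min_le_right _ _
      _ = ((A y₂ - A y₀) / (y₂ - y₀) - m) * (y - y₀) := by
          have : y₂ - y₀ ≠ 0 := by linarith
          field_simp
      _ ≤ ((A y - A y₀) / (y - y₀) - m) * (y - y₀) := by gcongr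
      _ = _ := by
          have := hpos.ne'
          field_simp

theorem tendsto_taylor_two {A : ℝ → ℝ} (hA : ContDiff ℝ 2 A) (y₀ : ℝ) :
    Tendsto (fun y => (A y - A y₀ - (y - y₀) * deriv A y₀) / (y - y₀) ^ 2) (𝓝[≠] y₀)
      (𝓝 (iteratedDeriv 2 A y₀ / 2)) := by
  have h := (taylor_tendsto (n := 2) convex_univ (Set.mem_univ y₀) hA.contDiffOn).mono_left
    (nhdsWithin_mono _ (Set.subset_univ {y₀}ᶜ))
  have h' := h.add_const (iteratedDeriv 2 A y₀ / 2)
  rw [zero_add] at h'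
  refine h'.congr' ?_
  filter_upwards [self_mem_nhdsWithin] with y hy
  have hy' : y - y₀ ≠ 0 := sub_ne_zero.2 hy
  simp only [taylorWithinEval_succ, taylor_within_zero_eval, iteratedDerivWithin_univ,
    smul_eq_mul]
  norm_num
  field_simp
  ring

theorem integral_gaussianReal_inv_exp_sq {a V : ℝ} (ha : 0 < a) (hV : 0 < V) :
    ∫ z, (√(Real.pi / (V * a ^ 2 / 2)) * Real.exp ((a * z) ^ 2 / (4 * (V * a ^ 2 / 2))))⁻¹
      ∂(gaussianReal 0 V.toNNReal) = √(V * a ^ 2) / (2 * √Real.pi) := by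
  have hV' : V.toNNReal ≠ 0 := by simpa using hV
  have hcoe : (V.toNNReal : ℝ) = V := Real.coe_toNNReal V hV.le
  have hpi := Real.pi_pos
  rw [integral_gaussianReal_eq_integral_smul hV']
  have hpt : ∀ z : ℝ, gaussianPDFReal 0 V.toNNReal z •
      (√(Real.pi / (V * a ^ 2 / 2)) * Real.exp ((a * z) ^ 2 / (4 * (V * a ^ 2 / 2))))⁻¹ =
      (√(2 * Real.pi * V))⁻¹ * (√(Real.pi / (V * a ^ 2 / 2)))⁻¹ * Real.exp (-(1 / V) * z ^ 2) := by
    intro z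
    rw [gaussianPDFReal, hcoe, mul_inv, ← Real.exp_neg, smul_eq_mul]
    have : Real.exp (-(1 / V) * z ^ 2) = Real.exp (-(z - 0) ^ 2 / (2 * V)) *
        Real.exp (-((a * z) ^ 2 / (4 * (V * a ^ 2 / 2)))) := by
      rw [← Real.exp_add]
      congr 1
      field_simp
      ring
    rw [this]
    ring
  simp_rw [hpt]
  rw [integral_const_mul, integral_gaussian, ← Real.sqrt_inv, ← Real.sqrt_inv,
    ← Real.sqrt_mul (by positivity), ← Real.sqrt_mul (by positivity)]
  have h2 : 2 * √Real.pi = √(4 * Real.pi) := by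
    rw [Real.sqrt_mul (by norm_num), show (4 : ℝ) = 2 ^ 2 by norm_num,
      Real.sqrt_sq (by norm_num)]
  rw [h2, ← Real.sqrt_div (by positivity)]
  congr 1
  field_simp
  ring

theorem pi_withDensity_ofReal {X : Type*} [MeasurableSpace X] (ν : Measure X) [SigmaFinite ν]
    {f : X → ℝ} (hf0 : ∀ x, 0 ≤ f x) (hfi : Integrable f ν) (n : ℕ) :
    Measure.pi (fun _ : Fin n => ν.withDensity fun x => ENNReal.ofReal (f x)) =
      (Measure.pi fun _ : Fin n => ν).withDensity fun s => ENNReal.ofReal (∏ i, f (s i)) := by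
  have := isFiniteMeasure_withDensity_ofReal hfi.2
  refine Measure.pi_eq fun s hs => ?_
  have hprod : Integrable (fun u : Fin n → X => ∏ i, f (u i))
      (Measure.pi fun i : Fin n => ν.restrict (s i)) :=
    Integrable.fintype_prod_dep fun i => hfi.restrict
  rw [withDensity_apply _ (.univ_pi hs), Measure.restrict_pi_pi,
    ← ofReal_integral_eq_lintegral_ofReal hprod
      (.of_forall fun u => Finset.prod_nonneg fun i _ => hf0 _),
    integral_fintype_prod_eq_prod, ENNReal.ofReal_prod_of_nonneg
      (fun i _ => integral_nonneg hf0)]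
  refine Finset.prod_congr rfl fun i _ => ?_
  rw [withDensity_apply _ (hs i), ofReal_integral_eq_lintegral_ofReal hfi.restrict
    (.of_forall hf0)]

theorem integral_mul_prod_eq_integral_pi_withDensity {X : Type*} [MeasurableSpace X]
    (ν : Measure X) [SigmaFinite ν] {f : X → ℝ} (hf : Measurable f) (hf0 : ∀ x, 0 ≤ f x)
    (hfi : Integrable f ν) {n : ℕ} (g : (Fin n → X) → ℝ) :
    ∫ s, g s * ∏ i, f (s i) ∂(Measure.pi fun _ => ν) =
      ∫ s, g s ∂(Measure.pi fun _ => ν.withDensity fun x => ENNReal.ofReal (f x)) := by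
  rw [pi_withDensity_ofReal ν hf0 hfi, integral_withDensity_eq_integral_toReal_smul
    (by fun_prop) (.of_forall fun _ => ENNReal.ofReal_lt_top)]
  refine integral_congr_ae (.of_forall fun s => ?_)
  simp only [smul_eq_mul]
  rw [ENNReal.toReal_ofReal (Finset.prod_nonneg fun i _ => hf0 _), mul_comm]

theorem measurable_setIntegral_mul_exp {Θ : Set ℝ} {ρ x D : ℝ → ℝ} (hΘ : MeasurableSet Θ)
    (hρ : ContinuousOn ρ Θ) (hx : ContinuousOn x Θ) (hD : ContinuousOn D Θ) (k l : ℝ) :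
    Measurable fun z => ∫ θ in Θ, ρ θ * Real.exp (k * x θ * z - l * D θ) := by
  classical
  have h : ∀ f : ℝ → ℝ, ContinuousOn f Θ → Measurable (Θ.indicator f) := fun f hf => by
    simpa only [Set.piecewise_eq_indicator] using!
      hf.measurable_piecewise (g := fun _ => 0) continuousOn_const hΘ
  have heq : (fun z => ∫ θ in Θ, ρ θ * Real.exp (k * x θ * z - l * D θ)) = fun z =>
      ∫ θ in Θ, Θ.indicator ρ θ * Real.exp (k * Θ.indicator x θ * z - l * Θ.indicator D θ) := by
    funext z
    refine setIntegral_congr_fun hΘ fun θ hθ => ?_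
    simp only [Set.indicator_of_mem hθ]
  have hρm := h ρ hρ
  have hxm := h x hx
  have hDm := h D hD
  rw [heq]
  refine (StronglyMeasurable.integral_prod_right' (f := fun q : ℝ × ℝ => Θ.indicator ρ q.2 *
    Real.exp (k * Θ.indicator x q.2 * q.1 - l * Θ.indicator D q.2)) ?_).measurable
  exact Measurable.stronglyMeasurable (by fun_prop)

/-- The moments of the sufficient statistic of an exponential family, at an interior natural
parameter, are the derivatives of the log-partition function. -/
theorem moments_withDensity_exp {X : Type*} [MeasurableSpace X] {ν : Measure X} {T B : X → ℝ}
    (hT : Measurable T) (hB : Measurable B) {A : ℝ → ℝ} (hA : ContDiff ℝ 2 A) {y₀ : ℝ}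
    (hnorm : ∀ᶠ y in 𝓝 y₀, ∫ x, Real.exp (y * T x - A y - B x) ∂ν = 1)
    {μ : Measure X}
    (hμ : μ = ν.withDensity fun x => ENNReal.ofReal (Real.exp (y₀ * T x - A y₀ - B x))) :
    IsProbabilityMeasure μ ∧ MemLp T 2 μ ∧ ∫ x, T x ∂μ = deriv A y₀ ∧
      Var[T; μ] = iteratedDeriv 2 A y₀ := by
  have hcont : Tendsto (fun t => y₀ + t) (𝓝 0) (𝓝 y₀) := by
    simpa using (continuous_const_add y₀).tendsto 0
  have hpt : ∀ t x, (ENNReal.ofReal (Real.exp (y₀ * T x - A y₀ - B x))).toReal •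
      Real.exp (t * T x) = Real.exp (A (y₀ + t) - A y₀) *
        Real.exp ((y₀ + t) * T x - A (y₀ + t) - B x) := by
    intro t x
    rw [ENNReal.toReal_ofReal (Real.exp_pos _).le, smul_eq_mul, ← Real.exp_add, ← Real.exp_add]
    ring_nf
  have hmeas : Measurable fun x => ENNReal.ofReal (Real.exp (y₀ * T x - A y₀ - B x)) := by
    fun_prop
  have hmgf : ∀ᶠ t in 𝓝 (0 : ℝ), mgf T μ t = Real.exp (A (y₀ + t) - A y₀) := by
    filter_upwards [hcont.eventually hnorm] with t ht
    rw [mgf, hμ, integral_withDensity_eq_integral_toReal_smul hmeas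
      (.of_forall fun _ => ENNReal.ofReal_lt_top)]
    simp_rw [hpt]
    rw [integral_const_mul, ht, mul_one]
  have hintg : ∀ᶠ t in 𝓝 (0 : ℝ), t ∈ integrableExpSet T μ := by
    filter_upwards [hmgf] with t ht
    by_contra hnot
    exact (Real.exp_pos _).ne' (ht.symm.trans (mgf_undef hnot))
  have h0 : 0 ∈ interior (integrableExpSet T μ) := mem_interior_iff_mem_nhds.2 hintg
  have hprob : IsProbabilityMeasure μ := by
    have h := hmgf.self_of_nhds
    rw [mgf_zero', add_zero, sub_self, Real.exp_zero] at h
    exact ⟨by simpa [Measure.real, ENNReal.toReal_eq_one_iff] using h⟩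
  have hcgf : cgf T μ =ᶠ[𝓝 0] fun t => A (y₀ + t) - A y₀ := by
    filter_upwards [hmgf] with t ht
    rw [cgf, ht, Real.log_exp]
  have hmean : ∫ x, T x ∂μ = deriv A y₀ := by
    have h := deriv_cgf_zero h0
    rw [hcgf.deriv_eq, deriv_sub_const, deriv_comp_const_add, add_zero] at h
    simpa using h.symm
  refine ⟨hprob, by simpa using memLp_of_mem_interior_integrableExpSet h0 2, hmean, ?_⟩
  have h := iteratedDeriv_two_cgf_eq_integral h0
  rw [deriv_cgf_zero h0, mgf_zero] at h
  rw [variance_eq_integral hT.aemeasurable]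
  have h2 : iteratedDeriv 2 (cgf T μ) 0 = iteratedDeriv 2 A y₀ := by
    rw [hcgf.iteratedDeriv_eq, iteratedDeriv_fun_sub]
    · simp [iteratedDeriv_comp_const_add, iteratedDeriv_const]
    · exact (hA.comp (by fun_prop : ContDiff ℝ 2 fun t => y₀ + t)).contDiffAt
    · exact contDiffAt_const
  rw [h2] at h
  simpa using h.symm

theorem strictMonoOn_of_forall_hasDerivWithinAt_pos {Θ : Set ℝ} (hΘ : Convex ℝ Θ) {η ηd : ℝ → ℝ}
    (hη : ∀ θ ∈ Θ, HasDerivWithinAt η (ηd θ) Θ θ) (hηd : ∀ θ ∈ Θ, 0 < ηd θ) :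
    StrictMonoOn η Θ :=
  strictMonoOn_of_hasDerivWithinAt_pos hΘ (fun θ hθ => (hη θ hθ).continuousWithinAt)
    (fun θ hθ => (hη θ (interior_subset hθ)).mono interior_subset)
    fun θ hθ => hηd θ (interior_subset hθ)

theorem StrictMonoOn.image_mem_nhds_of_continuousOn {s : Set ℝ} {f : ℝ → ℝ} {t : ℝ}
    (hf : StrictMonoOn f s) (hs : IsPreconnected s) (hfc : ContinuousOn f s) (ht : s ∈ 𝓝 t) :
    f '' s ∈ 𝓝 (f t) := by
  obtain ⟨l, u, htlu, hlu⟩ := mem_nhds_iff_exists_Ioo_subset.1 ht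
  obtain ⟨l', hl', hlt⟩ := exists_between htlu.1
  obtain ⟨u', htu, hu'⟩ := exists_between htlu.2
  have hls : l' ∈ s := hlu ⟨hl', by linarith⟩
  have hus : u' ∈ s := hlu ⟨by linarith, hu'⟩
  have hts : t ∈ s := mem_of_mem_nhds ht
  exact Filter.mem_of_superset (Icc_mem_nhds (hf hls hts hlt) (hf hts hus htu))
    ((hs.image f hfc).ordConnected.out (Set.mem_image_of_mem f hls) (Set.mem_image_of_mem f hus))

theorem convexOn_image_of_iteratedDeriv_two_nonneg {Θ : Set ℝ} (hΘ : Convex ℝ Θ) {η A : ℝ → ℝ}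
    (hη : ContinuousOn η Θ) (hA : ContDiff ℝ 2 A)
    (hA'' : ∀ θ ∈ Θ, 0 ≤ iteratedDeriv 2 A (η θ)) : ConvexOn ℝ (η '' Θ) A := by
  have hconv : Convex ℝ (η '' Θ) :=
    (hΘ.isPreconnected.image η hη).ordConnected.convex
  refine convexOn_of_deriv2_nonneg' hconv (hA.differentiable two_ne_zero).differentiableOn ?_ ?_
  · have : ContDiff ℝ 1 (deriv A) := (contDiff_succ_iff_deriv.1
      (show ContDiff ℝ (1 + 1) A by simpa [one_add_one_eq_two] using hA)).2.2
    exact (this.differentiable one_ne_zero).differentiableOn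
  · rintro _ ⟨θ, hθ, rfl⟩
    simpa [iteratedDeriv_eq_iterate] using hA'' θ hθ

/-- The posterior density at an interior point `t` of the parameter set, written as a function of
the standardized sufficient statistic `z` and divided by `√n`. -/
noncomputable def scaledPosterior (Θ : Set ℝ) (π η A : ℝ → ℝ) (t : ℝ) (n : ℕ) (z : ℝ) : ℝ :=
  (√n * ∫ θ in Θ, π θ / π t * Real.exp (√n * (η θ - η t) * z -
    n * (A (η θ) - A (η t) - (η θ - η t) * deriv A (η t))))⁻¹

/-- Uniform boundedness in `z` and locally uniform limit of the scaled posterior density. -/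
theorem scaledPosterior_asymptotics {Θ : Set ℝ} (hΘ : Convex ℝ Θ) {η ηd A π : ℝ → ℝ} {t : ℝ}
    (hη : ∀ θ ∈ Θ, HasDerivWithinAt η (ηd θ) Θ θ) (hηd : ∀ θ ∈ Θ, 0 < ηd θ)
    (hA : ContDiff ℝ 2 A) (hA'' : ∀ θ ∈ Θ, 0 < iteratedDeriv 2 A (η θ))
    (hπc : ContinuousOn π Θ) (hπpos : ∀ θ ∈ Θ, 0 < π θ) (hπi : IntegrableOn π Θ)
    (ht : Θ ∈ 𝓝 t) :
    (∀ n, Measurable (scaledPosterior Θ π η A t n)) ∧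
    (∃ C, ∀ n : ℕ, 1 ≤ n → ∀ z, |scaledPosterior Θ π η A t n z| ≤ C) ∧
    ∀ z₀, Tendsto (fun q : ℕ × ℝ => scaledPosterior Θ π η A t q.1 q.2) (atTop ×ˢ 𝓝 z₀)
      (𝓝 (√(Real.pi / (iteratedDeriv 2 A (η t) * ηd t ^ 2 / 2)) *
        Real.exp ((ηd t * z₀) ^ 2 / (4 * (iteratedDeriv 2 A (η t) * ηd t ^ 2 / 2))))⁻¹) := by
  have htΘ : t ∈ Θ := mem_of_mem_nhds ht
  have hmeas : MeasurableSet Θ := hΘ.ordConnected.measurableSet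
  have hηc : ContinuousOn η Θ := fun θ hθ => (hη θ hθ).continuousWithinAt
  have hmono : StrictMonoOn η Θ := strictMonoOn_of_forall_hasDerivWithinAt_pos hΘ hη hηd
  set a := ηd t with ha_def
  set V := iteratedDeriv 2 A (η t) with hV_def
  set J := V * a ^ 2 / 2 with hJ_def
  have ha : 0 < a := hηd t htΘ
  have hV : 0 < V := hA'' t htΘ
  have hJ : 0 < J := by positivity
  set ρ : ℝ → ℝ := fun θ => π θ / π t with hρ_def
  set x : ℝ → ℝ := fun θ => η θ - η t with hx_def
  set D : ℝ → ℝ := fun θ => A (η θ) - A (η t) - (η θ - η t) * deriv A (η t) with hD_def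
  have hρc : ContinuousOn ρ Θ := hπc.div_const _
  have hxc : ContinuousOn x Θ := hηc.sub continuousOn_const
  have hDc : ContinuousOn D Θ :=
    ((hA.continuous.comp_continuousOn hηc).sub continuousOn_const).sub (hxc.mul continuousOn_const)
  have hρt : ρ t = 1 := div_self (hπpos t htΘ).ne'
  have hηt : HasDerivAt η a t := (hη t htΘ).hasDerivAt ht
  have hxlim : Tendsto (fun θ => x θ / (θ - t)) (𝓝[≠] t) (𝓝 a) := by
    refine (hasDerivAt_iff_tendsto_slope.1 hηt).congr fun θ => ?_
    rw [slope_def_field]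
  have hηne : Tendsto η (𝓝[≠] t) (𝓝[≠] (η t)) := by
    refine tendsto_nhdsWithin_iff.2 ⟨hηt.continuousAt.mono_left nhdsWithin_le_nhds, ?_⟩
    filter_upwards [self_mem_nhdsWithin, nhdsWithin_le_nhds ht] with θ hθ hθΘ h
    exact hθ (hmono.injOn hθΘ htΘ h)
  have hDlim : Tendsto (fun θ => D θ / (θ - t) ^ 2) (𝓝[≠] t) (𝓝 J) := by
    have h := ((tendsto_taylor_two hA (η t)).comp hηne).mul (hxlim.pow 2)
    rw [show iteratedDeriv 2 A (η t) / 2 * a ^ 2 = J by rw [hJ_def, hV_def]; ring] at h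
    refine h.congr' ?_
    filter_upwards [hηne self_mem_nhdsWithin] with θ hθ
    have : η θ - η t ≠ 0 := sub_ne_zero.2 hθ
    simp only [Function.comp_apply, hD_def, hx_def]
    field_simp
  obtain ⟨r, hr, hball, hloc⟩ := exists_ball_local_bounds ht ha hJ (hρc.continuousAt ht) hρt
    (by simp [hx_def]) (by simp [hD_def]) hxlim hDlim
  have hmem : ∀ s : ℝ, |s| < r → t + s ∈ Metric.ball t r := fun s hs => by
    simpa [Real.dist_eq] using hs
  have hr2 : |r / 2| < r := by rw [abs_of_pos (by positivity)]; linarith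
  have hl := hmem (-(r / 2)) (by rwa [abs_neg])
  have hu := hmem (r / 2) hr2
  have hlΘ := hball hl
  have huΘ := hball hu
  have hηl : η (t + -(r / 2)) < η t := hmono hlΘ htΘ (by linarith)
  have hηu : η t < η (t + r / 2) := hmono htΘ huΘ (by linarith)
  have hDl : 0 < D (t + -(r / 2)) := lt_of_lt_of_le (by
    rw [add_sub_cancel_left, neg_sq]; positivity) (hloc _ hl).2.2.2.2.1
  have hDu : 0 < D (t + r / 2) := lt_of_lt_of_le (by
    rw [add_sub_cancel_left]; positivity) (hloc _ hu).2.2.2.2.1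
  obtain ⟨κ, hκ, hfar⟩ := (convexOn_image_of_iteratedDeriv_two_nonneg hΘ hηc hA
    fun θ hθ => (hA'' θ hθ).le).exists_mul_abs_le (Set.mem_image_of_mem η htΘ)
    (Set.mem_image_of_mem η hlΘ) (Set.mem_image_of_mem η huΘ) hηl hηu hDl hDu
  have hδ : 0 < min (η t - η (t + -(r / 2))) (η (t + r / 2) - η t) :=
    lt_min (sub_pos.2 hηl) (sub_pos.2 hηu)
  have hout : ∀ θ ∈ Θ \ Metric.ball t r, η θ ≤ η (t + -(r / 2)) ∨ η (t + r / 2) ≤ η θ := by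
    rintro θ ⟨hθΘ, hθ⟩
    rw [Metric.mem_ball, Real.dist_eq, not_lt, le_abs] at hθ
    rcases hθ with hθ | hθ
    · exact .inr (hmono.monotoneOn huΘ hθΘ (by linarith))
    · exact .inl (hmono.monotoneOn hθΘ hlΘ (by linarith))
  refine ⟨fun n => ((measurable_setIntegral_mul_exp hmeas hρc hxc hDc √n n).const_mul √n).inv,
    ⟨(r * (1 / 2 * Real.exp (-(2 * J * r ^ 2))))⁻¹, fun n hn z => ?_⟩, fun z₀ => ?_⟩
  · exact abs_inv_sqrt_mul_setIntegral_le hmeas hr hball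
      (fun θ hθ => (div_pos (hπpos θ hθ) (hπpos t htΘ)).le) (fun θ hθ => (hloc θ hθ).1)
      (by positivity) (fun θ hθ => (hloc θ hθ).2.2.2.1) (fun θ hθ => (hloc θ hθ).2.2.2.2.2) hn z
  · refine (tendsto_sqrt_mul_setIntegral hmeas hr hball (by positivity : 0 ≤ 2 * a)
      (half_pos hJ) hJ hκ hδ hρc hxc hDc hρt (hπi.div_const _)
      (fun θ hθ => (div_pos (hπpos θ hθ) (hπpos t htΘ)).le) (fun θ hθ => (hloc θ hθ).2.1)
      (fun θ hθ => (hloc θ hθ).2.2.1) (fun θ hθ => (hloc θ hθ).2.2.2.2.1)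
      (fun θ hθ => ⟨hfar _ (Set.mem_image_of_mem η hθ.1) (hout θ hθ), ?_⟩)
      hxlim hDlim z₀).inv₀ (by positivity)
    rcases hout θ hθ with h | h
    · exact (min_le_left _ _).trans ((by linarith : _ ≤ -(η θ - η t)).trans (neg_le_abs _))
    · exact (min_le_right _ _).trans ((by linarith : _ ≤ η θ - η t).trans (le_abs_self _))

/-- The posterior density at `t` depends on the sample only through the standardized sum of `T`. -/
theorem prod_mul_div_setIntegral_eq_sqrt_mul_scaledPosterior {X : Type*} {Θ : Set ℝ}
    {π η A : ℝ → ℝ} {T B : X → ℝ} {p : ℝ → X → ℝ}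
    (hp : ∀ θ x, p θ x = Real.exp (η θ * T x - A (η θ) - B x)) {t : ℝ} (hπt : 0 < π t) {n : ℕ}
    (hn : 1 ≤ n) (s : Fin n → X) :
    (∏ i, p t (s i)) * π t / ∫ θ in Θ, (∏ i, p θ (s i)) * π θ =
      √n * scaledPosterior Θ π η A t n ((√n)⁻¹ * (∑ i, T (s i) - n * deriv A (η t))) := by
  have hs : (0 : ℝ) < √n := Real.sqrt_pos.2 (by exact_mod_cast hn)
  have hprod : ∀ θ, ∏ i, p θ (s i) =
      Real.exp (η θ * ∑ i, T (s i) - n * A (η θ) - ∑ i, B (s i)) := by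
    intro θ
    simp only [hp, ← Real.exp_sum, Finset.sum_sub_distrib, Finset.mul_sum, Finset.sum_const,
      Finset.card_univ, Fintype.card_fin, nsmul_eq_mul]
  have hpos : 0 < ∏ i, p t (s i) := by rw [hprod]; positivity
  have hintg : ∀ θ, (∏ i, p θ (s i)) * π θ = (∏ i, p t (s i)) * π t * (π θ / π t *
      Real.exp (√n * (η θ - η t) * ((√n)⁻¹ * (∑ i, T (s i) - n * deriv A (η t))) -
        n * (A (η θ) - A (η t) - (η θ - η t) * deriv A (η t)))) := by
    intro θ
    have hexp : √n * (η θ - η t) * ((√n)⁻¹ * (∑ i, T (s i) - n * deriv A (η t))) =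
        (η θ - η t) * (∑ i, T (s i) - n * deriv A (η t)) := by
      field_simp
    have h : ∏ i, p θ (s i) = (∏ i, p t (s i)) *
        Real.exp (√n * (η θ - η t) * ((√n)⁻¹ * (∑ i, T (s i) - n * deriv A (η t))) -
          n * (A (η θ) - A (η t) - (η θ - η t) * deriv A (η t))) := by
      rw [hexp, hprod, hprod, ← Real.exp_add]
      ring_nf
    rw [h]
    field_simp
  rw [funext hintg, integral_const_mul, scaledPosterior, mul_inv, mul_inv_cancel_left₀ hs.ne',
    div_mul_eq_div_div, div_self (mul_pos hpos hπt).ne', one_div]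

/-- The expected posterior at the true interior parameter `t` grows like
`√n * √I / (2 * √π)`, with `I` the Fisher information at `t`. -/
theorem tendsto_expectedPosterior_self_div_sqrt {X : Type*} [MeasurableSpace X] (ν : Measure X)
    [SigmaFinite ν] {Θ : Set ℝ} (hΘ : Convex ℝ Θ) {η ηd A π : ℝ → ℝ} {T B : X → ℝ}
    (hη : ∀ θ ∈ Θ, HasDerivWithinAt η (ηd θ) Θ θ) (hηd : ∀ θ ∈ Θ, 0 < ηd θ)
    (hT : Measurable T) (hB : Measurable B)
    (hA : ContDiff ℝ 2 A) (hA'' : ∀ θ ∈ Θ, 0 < iteratedDeriv 2 A (η θ)) {p : ℝ → X → ℝ}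
    (hp : ∀ θ x, p θ x = Real.exp (η θ * T x - A (η θ) - B x))
    (hpint : ∀ θ ∈ Θ, ∫ x, p θ x ∂ν = 1) (hπc : ContinuousOn π Θ) (hπpos : ∀ θ ∈ Θ, 0 < π θ)
    (hπi : IntegrableOn π Θ) {t : ℝ} (ht : Θ ∈ 𝓝 t) :
    Tendsto (fun n : ℕ => expectedPosterior ν Θ π p t t n / √n) atTop
      (𝓝 (√(iteratedDeriv 2 A (η t) * ηd t ^ 2) / (2 * √Real.pi))) := by
  have htΘ : t ∈ Θ := mem_of_mem_nhds ht
  have hV := hA'' t htΘ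
  have ha := hηd t htΘ
  have himage : η '' Θ ∈ 𝓝 (η t) :=
    (strictMonoOn_of_forall_hasDerivWithinAt_pos hΘ hη hηd).image_mem_nhds_of_continuousOn
      hΘ.isPreconnected (fun θ hθ => (hη θ hθ).continuousWithinAt) ht
  have hnorm : ∀ᶠ y in 𝓝 (η t), ∫ x, Real.exp (y * T x - A y - B x) ∂ν = 1 := by
    filter_upwards [himage]
    rintro _ ⟨θ, hθ, rfl⟩
    simpa only [hp] using hpint θ hθ
  have hpt : p t = fun x => Real.exp (η t * T x - A (η t) - B x) := funext (hp t)
  obtain ⟨hprob, hL2, hmean, hvar⟩ := moments_withDensity_exp hT hB hA hnorm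
    (μ := ν.withDensity fun x => ENNReal.ofReal (p t x)) (by rw [hpt])
  obtain ⟨hGm, ⟨C, hC⟩, hconv⟩ := scaledPosterior_asymptotics hΘ hη hηd hA hA'' hπc hπpos hπi ht
  have hlim := tendsto_integral_pi_standardized_sum _ hT hL2 hGm (by
    refine Continuous.inv₀ (by fun_prop) fun z => ?_
    positivity) ((eventually_ge_atTop 1).mono hC) hconv
  rw [hvar, hmean, integral_gaussianReal_inv_exp_sq ha hV] at hlim
  refine hlim.congr' ?_
  filter_upwards [eventually_ge_atTop 1] with n hn
  have hs : (0 : ℝ) < √n := Real.sqrt_pos.2 (by exact_mod_cast hn)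
  have hpi : Integrable (p t) ν := by
    by_contra h
    simpa [integral_undef h] using hpint t htΘ
  rw [expectedPosterior, integral_mul_prod_eq_integral_pi_withDensity ν
    (by rw [hpt]; fun_prop) (fun x => by rw [hp]; positivity) hpi]
  simp_rw [prod_mul_div_setIntegral_eq_sqrt_mul_scaledPosterior hp (hπpos t htΘ) hn]
  rw [integral_const_mul, mul_div_cancel_left₀ _ hs.ne']

theorem sqrt_mul_eq_mul_exp_of_midpoint {X : Type*} {η A : ℝ → ℝ} {T B : X → ℝ} {p : ℝ → X → ℝ}
    (hp : ∀ θ x, p θ x = Real.exp (η θ * T x - A (η θ) - B x)) {θ₀ θ₁ θ₂ : ℝ}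
    (hθ₂ : η θ₂ = (η θ₀ + η θ₁) / 2) (x : X) :
    √(p θ₀ x * p θ₁ x) = p θ₂ x * Real.exp (A (η θ₂) - (A (η θ₀) + A (η θ₁)) / 2) := by
  rw [hp, hp, hp, ← Real.exp_add, ← Real.exp_add, Real.sqrt_eq_rpow, ← Real.exp_mul, hθ₂]
  ring_nf

theorem integral_sqrt_mul_eq_exp_of_midpoint {X : Type*} [MeasurableSpace X] {ν : Measure X}
    {η A : ℝ → ℝ} {T B : X → ℝ} {p : ℝ → X → ℝ}
    (hp : ∀ θ x, p θ x = Real.exp (η θ * T x - A (η θ) - B x)) {θ₀ θ₁ θ₂ : ℝ}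
    (hθ₂ : η θ₂ = (η θ₀ + η θ₁) / 2) (hpint : ∫ x, p θ₂ x ∂ν = 1) :
    ∫ x, √(p θ₀ x * p θ₁ x) ∂ν = Real.exp (A (η θ₂) - (A (η θ₀) + A (η θ₁)) / 2) := by
  simp_rw [sqrt_mul_eq_mul_exp_of_midpoint hp hθ₂]
  rw [integral_mul_const, hpint, one_mul]

theorem prod_mul_prod_eq_sq_mul_pow {X : Type*} [MeasurableSpace X] {ν : Measure X}
    {η A : ℝ → ℝ} {T B : X → ℝ} {p : ℝ → X → ℝ}
    (hp : ∀ θ x, p θ x = Real.exp (η θ * T x - A (η θ) - B x)) {θ₀ θ₁ θ₂ : ℝ}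
    (hθ₂ : η θ₂ = (η θ₀ + η θ₁) / 2) (hpint : ∫ x, p θ₂ x ∂ν = 1) {n : ℕ} (s : Fin n → X) :
    (∏ i, p θ₀ (s i)) * (∏ i, p θ₁ (s i)) =
      (∏ i, p θ₂ (s i)) ^ 2 * ((∫ x, √(p θ₀ x * p θ₁ x) ∂ν) ^ 2) ^ n := by
  have hx : ∀ x, p θ₀ x * p θ₁ x = p θ₂ x ^ 2 *
      Real.exp (A (η θ₂) - (A (η θ₀) + A (η θ₁)) / 2) ^ 2 := by
    intro x
    rw [← mul_pow, ← sqrt_mul_eq_mul_exp_of_midpoint hp hθ₂, Real.sq_sqrt]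
    rw [hp, hp]
    positivity
  rw [integral_sqrt_mul_eq_exp_of_midpoint hp hθ₂ hpint, ← Finset.prod_mul_distrib]
  simp_rw [hx]
  rw [Finset.prod_mul_distrib, Finset.prod_pow, Finset.prod_const, Finset.card_univ,
    Fintype.card_fin]

end

/-- One-dimensional exponential family setup.  For `θ₀ ≠ θ₁` in `Θ`, with
`θ₂ ∈ Θ` the point satisfying `η θ₂ = (η θ₀ + η θ₁)/2` assumed interior, Fisher information
`I₂ = A''(η θ₂) (η' θ₂)²`, and `w = (∫ √(p_{θ₀} p_{θ₁}) dν)²`: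
`ψ_{θ₀,θ₁}(n) = (π θ₀ / π θ₂) ψ_{θ₂,θ₂}(n) wⁿ` for `n ≥ 1`, and `ψ_{θ₀,θ₁}(n)` is
asymptotically equivalent to `(π θ₀ / π θ₂) (√I₂ / (2√π)) √n wⁿ` as `n → ∞`. -/
theorem exponential_family_asymptotics_different_parameters
    {X : Type*} [MeasurableSpace X] (ν : Measure X) [SigmaFinite ν]
    (Θ : Set ℝ) (hΘconv : Convex ℝ Θ) (hΘnontriv : ∃ a ∈ Θ, ∃ b ∈ Θ, a ≠ b)
    (η ηd : ℝ → ℝ)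
    (hη : ∀ θ ∈ Θ, HasDerivWithinAt η (ηd θ) Θ θ)
    (hηd : ∀ θ ∈ Θ, 0 < ηd θ)
    (T B : X → ℝ) (hT : Measurable T) (hB : Measurable B)
    (A : ℝ → ℝ) (hA : ContDiff ℝ 2 A)
    (hA'' : ∀ θ ∈ Θ, 0 < iteratedDeriv 2 A (η θ))
    (p : ℝ → X → ℝ)
    (hp : ∀ θ x, p θ x = Real.exp (η θ * T x - A (η θ) - B x))
    (hpint : ∀ θ ∈ Θ, ∫ x, p θ x ∂ν = 1)
    (π : ℝ → ℝ) (hπc : ContinuousOn π Θ) (hπpos : ∀ θ ∈ Θ, 0 < π θ)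
    (hπint : ∫ θ in Θ, π θ = 1)
    (θ₀ θ₁ : ℝ) (hθ₀ : θ₀ ∈ Θ) (hθ₁ : θ₁ ∈ Θ) (hne : θ₀ ≠ θ₁)
    (θ₂ : ℝ) (hθ₂mem : θ₂ ∈ Θ) (hθ₂ : η θ₂ = (η θ₀ + η θ₁) / 2)
    (hθ₂int : θ₂ ∈ interior Θ)
    (I₂ : ℝ) (hI₂ : I₂ = iteratedDeriv 2 A (η θ₂) * (ηd θ₂) ^ 2)
    (w : ℝ) (hw : w = (∫ x, Real.sqrt (p θ₀ x * p θ₁ x) ∂ν) ^ 2) :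
    (∀ n : ℕ, 1 ≤ n →
      expectedPosterior ν Θ π p θ₀ θ₁ n =
        (π θ₀ / π θ₂) * expectedPosterior ν Θ π p θ₂ θ₂ n * w ^ n) ∧
    Filter.Tendsto
      (fun n : ℕ =>
        expectedPosterior ν Θ π p θ₀ θ₁ n * (2 * Real.sqrt Real.pi) * π θ₂ /
          (π θ₀ * Real.sqrt I₂ * Real.sqrt n * w ^ n))
      Filter.atTop (nhds 1) := by
  have hπ₂ := hπpos θ₂ hθ₂mem
  have hπ₀ := hπpos θ₀ hθ₀
  have hid : ∀ n : ℕ, expectedPosterior ν Θ π p θ₀ θ₁ n =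
      (π θ₀ / π θ₂) * expectedPosterior ν Θ π p θ₂ θ₂ n * w ^ n := by
    intro n
    rw [expectedPosterior, expectedPosterior, ← integral_const_mul, ← integral_mul_const]
    refine integral_congr_ae (.of_forall fun s => ?_)
    have h := prod_mul_prod_eq_sq_mul_pow hp hθ₂ (hpint θ₂ hθ₂mem) s
    rw [← hw] at h
    have h' : ∀ d, (∏ i, p θ₀ (s i)) * π θ₀ / d * ∏ i, p θ₁ (s i) =
        ((∏ i, p θ₀ (s i)) * ∏ i, p θ₁ (s i)) * π θ₀ / d := fun d => by ring
    simp only [h', h]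
    field_simp
  refine ⟨fun n _ => hid n, ?_⟩
  have hw0 : 0 < w := by
    rw [hw, integral_sqrt_mul_eq_exp_of_midpoint hp hθ₂ (hpint θ₂ hθ₂mem)]
    positivity
  have hI₂pos : 0 < I₂ := by
    have := hA'' θ₂ hθ₂mem
    have := hηd θ₂ hθ₂mem
    rw [hI₂]
    positivity
  have hπi : IntegrableOn π Θ := by
    by_contra h
    rw [integral_undef h] at hπint
    exact zero_ne_one hπint
  have hlim := (tendsto_expectedPosterior_self_div_sqrt ν hΘconv hη hηd hT hB hA hA'' hp hpint hπc
    hπpos hπi (mem_interior_iff_mem_nhds.1 hθ₂int)).mul_const (2 * √Real.pi / √I₂)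
  have hsI : √I₂ ≠ 0 := (Real.sqrt_pos.2 hI₂pos).ne'
  have hspi : √Real.pi ≠ 0 := (Real.sqrt_pos.2 Real.pi_pos).ne'
  rw [← hI₂, div_mul_div_cancel₀ (by positivity), div_self hsI] at hlim
  refine hlim.congr' ?_
  filter_upwards [Filter.eventually_ge_atTop 1] with n hn
  have hs : √(n : ℝ) ≠ 0 := (Real.sqrt_pos.2 (by exact_mod_cast hn)).ne'
  have hwn : w ^ n ≠ 0 := (pow_pos hw0 n).ne'
  rw [hid]
  field_simp
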